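/- There exist β₀ > 0 and L > 0 such that for all β < β₀, all h ≥ 0 and all N ≥ 1, |ν(σ̄₁ σ̄_N)| ≤ L/N, where σ̄_i = σ_i¹ − σ_i² for two independent replicas σ¹, σ². -/

import Mathlib

open MeasureTheory ProbabilityTheory Finset

noncomputable section

/-- A spin configuration on `N` sites. -/
abbrev Cfg (N : ℕ) := Fin N → Bool

/-- The spin value `±1` of a Boolean. -/
def spin (b : Bool) : ℝ := if b then 1 else -1

/-- Minus the SK Hamiltonian. -/
def negH (N : ℕ) (β h : ℝ) (g : Fin N → Fin N → ℝ) (σ : Cfg N) : ℝ :=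
  (β / Real.sqrt N) *
      ∑ i : Fin N, ∑ j : Fin N, (if i < j then g i j * spin (σ i) * spin (σ j) else 0) +
    h * ∑ i : Fin N, spin (σ i)

/-- Gibbs average `⟨f⟩` of a function of `ι`-indexed replicas. -/
def gibbs (N : ℕ) (β h : ℝ) (g : Fin N → Fin N → ℝ) {ι : Type} [DecidableEq ι] [Fintype ι]
    (f : (ι → Cfg N) → ℝ) : ℝ :=
  (∑ σs : ι → Cfg N, f σs * ∏ l, Real.exp (negH N β h g (σs l))) /
    (∑ σ : Cfg N, Real.exp (negH N β h g σ)) ^ (Fintype.card ι)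

/-- The law of the disorder: i.i.d. standard Gaussians. -/
def gaussN (N : ℕ) : Measure (Fin N → Fin N → ℝ) :=
  Measure.pi fun _ => Measure.pi fun _ => gaussianReal 0 1

/-- `ν(f) = E⟨f⟩`. -/
def nu (N : ℕ) (β h : ℝ) {ι : Type} [DecidableEq ι] [Fintype ι]
    (f : (ι → Cfg N) → ℝ) : ℝ :=
  ∫ g, gibbs N β h g f ∂ gaussN N

/-- `S_l = Σ_i t_i (σ_i^{1(l)} - σ_i^{2(l)})`, replica pairs indexed by `Fin m × Fin 2`. -/
def Sbar (N m : ℕ) (t : Fin N → ℝ) (σs : Fin m × Fin 2 → Cfg N) (l : Fin m) : ℝ :=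
  ∑ i, t i * (spin (σs (l, 0) i) - spin (σs (l, 1) i))

/-- `a(k)`: the `k`-th moment of a standard Gaussian. -/
def gaussMoment (k : ℕ) : ℝ := ∫ x, x ^ k ∂ (gaussianReal 0 1 : Measure ℝ)

/-- The overlap `R_{l,l'}` of two configurations. -/
def overlap (N : ℕ) (σ τ : Cfg N) : ℝ := (∑ i, spin (σ i) * spin (τ i)) / N

section Gaussian

variable {ι : Type} [Fintype ι]

/-- The standard Gaussian measure on `ι → ℝ`. -/
abbrev stdGauss (ι : Type) [Fintype ι] : Measure (ι → ℝ) :=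
  Measure.pi fun _ => gaussianReal 0 1

/-- Applying measure preserving maps of `ℝ × ℝ` coordinatewise preserves the product of two
standard Gaussian measures. -/
lemma measurePreserving_coordwise {f : ι → ℝ × ℝ → ℝ × ℝ}
    (hf : ∀ i, MeasurePreserving (f i) ((gaussianReal 0 1).prod (gaussianReal 0 1))
      ((gaussianReal 0 1).prod (gaussianReal 0 1))) :
    MeasurePreserving
      (fun p : (ι → ℝ) × (ι → ℝ) =>
        ((fun i => (f i (p.1 i, p.2 i)).1), (fun i => (f i (p.1 i, p.2 i)).2)))
      ((stdGauss ι).prod (stdGauss ι)) ((stdGauss ι).prod (stdGauss ι)) := by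
  have h1 := measurePreserving_arrowProdEquivProdArrow ℝ ℝ ι
    (fun _ => gaussianReal 0 1) (fun _ => gaussianReal 0 1)
  exact (h1.comp (measurePreserving_pi _ _ hf)).comp (h1.symm _)

lemma measurePreserving_rotation (θ : ℝ) :
    MeasurePreserving
      (fun p : (ι → ℝ) × (ι → ℝ) =>
        ((fun i => Real.cos θ * p.1 i + Real.sin θ * p.2 i),
          (fun i => -Real.sin θ * p.1 i + Real.cos θ * p.2 i)))
      ((stdGauss ι).prod (stdGauss ι)) ((stdGauss ι).prod (stdGauss ι)) := by
  have h : MeasurePreserving (ContinuousLinearMap.rotation (E := ℝ) θ)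
      ((gaussianReal 0 1).prod (gaussianReal 0 1))
      ((gaussianReal 0 1).prod (gaussianReal 0 1)) := by
    refine ⟨(ContinuousLinearMap.rotation θ).continuous.measurable, ?_⟩
    refine IsGaussian.map_rotation_eq_self_of_forall_strongDual_eq_zero (fun L => ?_) θ
    have hL : (L : ℝ → ℝ) = fun x => x * L 1 := by
      ext x
      simpa using L.map_smul x 1
    rw [hL, integral_mul_const]
    simp
  exact measurePreserving_coordwise (fun _ => h)

lemma measurePreserving_mix (S : ι → Prop) [DecidablePred S] :
    MeasurePreserving (fun p : (ι → ℝ) × (ι → ℝ) => fun i => if S i then p.2 i else p.1 i)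
      ((stdGauss ι).prod (stdGauss ι)) (stdGauss ι) := by
  have h : ∀ i, MeasurePreserving (fun q : ℝ × ℝ => if S i then q.swap else q)
      ((gaussianReal 0 1).prod (gaussianReal 0 1))
      ((gaussianReal 0 1).prod (gaussianReal 0 1)) := by
    intro i
    by_cases hi : S i
    · simpa [hi] using Measure.measurePreserving_swap
    · simp only [hi, if_false]
      exact MeasurePreserving.id _
  convert! measurePreserving_fst.comp (measurePreserving_coordwise h) using 1
  ext p i
  by_cases hi : S i <;> simp [hi]

lemma memLp_eval_stdGauss (i : ι) : MemLp (fun b : ι → ℝ => b i) 2 (stdGauss ι) :=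
  (memLp_id_gaussianReal (μ := 0) (v := 1) 2).comp_measurePreserving
    (measurePreserving_eval (fun _ : ι => gaussianReal 0 1) i)

lemma integrable_sq_eval_stdGauss (i : ι) :
    Integrable (fun b : ι → ℝ => b i ^ 2) (stdGauss ι) :=
  (memLp_eval_stdGauss i).integrable_sq

lemma integral_sq_linear_stdGauss (e : ι → ℝ) :
    ∫ b, (∑ i, e i * b i) ^ 2 ∂stdGauss ι = ∑ i, e i ^ 2 := by
  have hL : ∀ i, MemLp (fun x : ℝ => e i * x) 2 (gaussianReal 0 1) := fun i =>
    (memLp_id_gaussianReal (μ := 0) (v := 1) 2).const_mul (e i)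
  have hv := variance_sum_pi (μ := fun _ : ι => gaussianReal 0 1)
    (X := fun i x => e i * x) hL
  have hm : ∫ b, (∑ i, fun b : ι → ℝ => e i * b i) b ∂stdGauss ι = 0 := by
    simp only [Finset.sum_apply]
    rw [integral_finsetSum _ fun i _ =>
      ((memLp_eval_stdGauss i).integrable (by norm_num)).const_mul _]
    refine Finset.sum_eq_zero fun i _ => ?_
    rw [integral_const_mul]
    have := integral_comp_eval (μ := fun _ : ι => gaussianReal 0 1) (i := i) (f := fun x : ℝ => x)
      (by fun_prop)
    rw [this]
    simp
  have hvar : ∀ i, Var[fun x : ℝ => e i * x; gaussianReal 0 1] = e i ^ 2 := by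
    intro i
    rw [variance_const_mul]
    have : Var[fun x : ℝ => x; gaussianReal 0 1] = 1 := by simp
    rw [this, mul_one]
  rw [variance_of_integral_eq_zero (by fun_prop) hm] at hv
  simpa [hvar] using hv

lemma sq_intervalIntegral_le {f : ℝ → ℝ} (hf : Continuous f) {a : ℝ} (ha : 0 < a) :
    (∫ t in (0 : ℝ)..a, f t) ^ 2 ≤ a * ∫ t in (0 : ℝ)..a, f t ^ 2 := by
  set m := (∫ t in (0 : ℝ)..a, f t) with hm
  have h0 : 0 ≤ ∫ t in (0 : ℝ)..a, (a * f t - m) ^ 2 :=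
    intervalIntegral.integral_nonneg ha.le fun t _ => sq_nonneg _
  have h1 : ∫ t in (0 : ℝ)..a, (a * f t - m) ^ 2 =
      a ^ 2 * (∫ t in (0 : ℝ)..a, f t ^ 2) - 2 * a * m * m + a * m ^ 2 := by
    have : ∀ t, (a * f t - m) ^ 2 = a ^ 2 * f t ^ 2 - 2 * a * m * f t + m ^ 2 := fun t => by ring
    simp only [this]
    rw [intervalIntegral.integral_add, intervalIntegral.integral_sub,
      intervalIntegral.integral_const_mul, intervalIntegral.integral_const_mul, ← hm]
    · simp
    all_goals exact Continuous.intervalIntegrable (by fun_prop) _ _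
  rw [h1] at h0
  have : 0 ≤ a * (a * (∫ t in (0 : ℝ)..a, f t ^ 2) - m ^ 2) := by nlinarith
  nlinarith [nonneg_of_mul_nonneg_right this ha]

/-- A Poincaré-type inequality for the odd part of a function of a standard Gaussian vector. -/
lemma integral_sq_sub_neg_le {F : (ι → ℝ) → ℝ} {D : (ι → ℝ) → ι → ℝ} {B : ℝ}
    (hF : ∀ (γ : ℝ → ι → ℝ) (γ' : ι → ℝ) (t : ℝ), (∀ i, HasDerivAt (fun s => γ s i) (γ' i) t) →
      HasDerivAt (fun s => F (γ s)) (∑ i, D (γ t) i * γ' i) t)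
    (hFc : Continuous F) (hFb : ∀ x, |F x| ≤ B)
    (hD : Continuous D) (hB : ∀ x i, |D x i| ≤ B) :
    ∫ b, (F b - F (-b)) ^ 2 ∂stdGauss ι ≤
      Real.pi ^ 2 * ∫ b, ∑ i, D b i ^ 2 ∂stdGauss ι := by
  set μ := stdGauss ι with hμ
  let rot : ℝ → (ι → ℝ) × (ι → ℝ) → (ι → ℝ) × (ι → ℝ) := fun θ p =>
    ((fun i => Real.cos θ * p.1 i + Real.sin θ * p.2 i),
      (fun i => -Real.sin θ * p.1 i + Real.cos θ * p.2 i))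
  let ψ : (ι → ℝ) × (ι → ℝ) → ℝ := fun p => ∑ i, D p.1 i * p.2 i
  have hDi : ∀ i, Continuous fun x => D x i := fun i => (continuous_apply i).comp hD
  have hψ : Continuous ψ := by
    refine continuous_finsetSum _ fun i _ => ?_
    exact ((hDi i).comp continuous_fst).mul ((continuous_apply i).comp continuous_snd)
  have hrot : Continuous fun q : ℝ × ((ι → ℝ) × (ι → ℝ)) => rot q.1 q.2 := by
    simp only [rot]; fun_prop
  have hpt : ∀ p : (ι → ℝ) × (ι → ℝ),
      (F p.1 - F (-p.1)) ^ 2 ≤ Real.pi * ∫ θ in (0 : ℝ)..Real.pi, ψ (rot θ p) ^ 2 := by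
    intro p
    have hcont : Continuous fun θ => ψ (rot θ p) :=
      hψ.comp (hrot.comp (Continuous.prodMk_left p))
    have hder : ∀ θ ∈ Set.uIcc 0 Real.pi,
        HasDerivAt (fun s => F ((rot s p).1)) (ψ (rot θ p)) θ := by
      intro θ _
      refine hF (fun s => (rot s p).1) ((rot θ p).2) θ fun i => ?_
      exact ((Real.hasDerivAt_cos θ).mul_const _).add ((Real.hasDerivAt_sin θ).mul_const _)
    have hint := intervalIntegral.integral_eq_sub_of_hasDerivAt hder
      (hcont.intervalIntegrable _ _)
    have hpi : (rot Real.pi p).1 = -p.1 := by ext i; simp [rot]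
    have hzero : (rot 0 p).1 = p.1 := by ext i; simp [rot]
    rw [hpi, hzero] at hint
    have := sq_intervalIntegral_le hcont Real.pi_pos
    rw [hint] at this
    linarith [sq_abs (F p.1 - F (-p.1)), sq_abs (F (-p.1) - F p.1), sub_sq_comm (F p.1) (F (-p.1))]
  have hψb : ∀ p : (ι → ℝ) × (ι → ℝ), ψ p ^ 2 ≤ (∑ _i : ι, B ^ 2) * ∑ i, p.2 i ^ 2 := by
    intro p
    refine (Finset.sum_mul_sq_le_sq_mul_sq _ _ _).trans ?_
    refine mul_le_mul_of_nonneg_right (Finset.sum_le_sum fun i _ => ?_)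
      (Finset.sum_nonneg fun i _ => sq_nonneg _)
    exact sq_le_sq' (abs_le.mp (hB p.1 _)).1 (abs_le.mp (hB p.1 _)).2
  have hsq1 : ∀ i, Integrable (fun p : (ι → ℝ) × (ι → ℝ) => p.1 i ^ 2) (μ.prod μ) := fun i =>
    (integrable_sq_eval_stdGauss i).comp_fst μ
  have hsq2 : ∀ i, Integrable (fun p : (ι → ℝ) × (ι → ℝ) => p.2 i ^ 2) (μ.prod μ) := fun i =>
    (integrable_sq_eval_stdGauss i).comp_snd μ
  have hψint : Integrable (fun p => ψ p ^ 2) (μ.prod μ) := by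
    refine Integrable.mono' (g := fun p => (∑ _i : ι, B ^ 2) * ∑ i, p.2 i ^ 2)
      ((integrable_finsetSum _ fun i _ => hsq2 i).const_mul _)
      (by exact (hψ.pow 2).aestronglyMeasurable) (Filter.Eventually.of_forall fun p => ?_)
    rw [Real.norm_of_nonneg (sq_nonneg _)]
    exact hψb p
  have hjoint : Integrable (Function.uncurry fun (θ : ℝ) p => ψ (rot θ p) ^ 2)
      ((volume.restrict (Set.uIoc 0 Real.pi)).prod (μ.prod μ)) := by
    have hG : Integrable (fun p : (ι → ℝ) × (ι → ℝ) =>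
        (∑ _i : ι, B ^ 2) * ∑ i, 2 * (p.1 i ^ 2 + p.2 i ^ 2)) (μ.prod μ) :=
      (integrable_finsetSum _ fun i _ => ((hsq1 i).add (hsq2 i)).const_mul 2).const_mul _
    have : IsFiniteMeasure ((volume : Measure ℝ).restrict (Set.uIoc 0 Real.pi)) := by
      rw [Set.uIoc_of_le Real.pi_pos.le]; infer_instance
    refine Integrable.mono' (hG.comp_snd (volume.restrict (Set.uIoc 0 Real.pi))) ?_
      (Filter.Eventually.of_forall fun q => ?_)
    · exact ((hψ.comp hrot).pow 2).aestronglyMeasurable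
    · simp only [Function.uncurry]
      rw [Real.norm_of_nonneg (sq_nonneg _)]
      refine (hψb _).trans ?_
      gcongr with i
      simp only [rot]
      nlinarith [sq_nonneg (Real.cos q.1 * q.2.1 i + Real.sin q.1 * q.2.2 i),
        Real.sin_sq_add_cos_sq q.1, sq_nonneg (q.2.1 i), sq_nonneg (q.2.2 i),
        congrArg (fun z => z * (q.2.1 i ^ 2 + q.2.2 i ^ 2)) (Real.sin_sq_add_cos_sq q.1)]
  have hLint : Integrable (fun b => (F b - F (-b)) ^ 2) μ := by
    refine Integrable.of_bound (C := (2 * B) ^ 2)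
      (by exact ((hFc.sub (hFc.comp continuous_neg)).pow 2).aestronglyMeasurable)
      (Filter.Eventually.of_forall fun b => ?_)
    rw [Real.norm_of_nonneg (sq_nonneg _)]
    have h1 := abs_le.mp (hFb b)
    have h2 := abs_le.mp (hFb (-b))
    exact sq_le_sq' (by linarith) (by linarith)
  have hRint : Integrable (fun p => ∫ θ in (0 : ℝ)..Real.pi, ψ (rot θ p) ^ 2) (μ.prod μ) := by
    simp only [intervalIntegral.integral_of_le Real.pi_pos.le]
    have := hjoint.integral_prod_right
    simpa only [Set.uIoc_of_le Real.pi_pos.le, Function.uncurry] using this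
  calc ∫ b, (F b - F (-b)) ^ 2 ∂μ
      = ∫ p, (F p.1 - F (-p.1)) ^ 2 ∂(μ.prod μ) := by
        rw [integral_fun_fst (fun b => (F b - F (-b)) ^ 2)]; simp
    _ ≤ ∫ p, Real.pi * (∫ θ in (0 : ℝ)..Real.pi, ψ (rot θ p) ^ 2) ∂(μ.prod μ) :=
        integral_mono (hLint.comp_fst μ) (hRint.const_mul _) hpt
    _ = Real.pi * ∫ θ in (0 : ℝ)..Real.pi, ∫ p, ψ (rot θ p) ^ 2 ∂(μ.prod μ) := by
        rw [integral_const_mul, ← intervalIntegral_integral_swap hjoint]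
    _ = Real.pi * ∫ _θ in (0 : ℝ)..Real.pi, ∫ p, ψ p ^ 2 ∂(μ.prod μ) := by
        congr 1
        refine intervalIntegral.integral_congr fun θ _ => ?_
        have hmp := measurePreserving_rotation (ι := ι) θ
        have := integral_map (μ := μ.prod μ) hmp.measurable.aemeasurable
          (f := fun p => ψ p ^ 2) (by exact (hψ.pow 2).aestronglyMeasurable)
        rw [hmp.map_eq] at this
        exact this.symm
    _ = Real.pi ^ 2 * ∫ p, ψ p ^ 2 ∂(μ.prod μ) := by
        rw [intervalIntegral.integral_const]; simp; ring
    _ = Real.pi ^ 2 * ∫ b, ∑ i, D b i ^ 2 ∂μ := by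
        rw [integral_prod _ hψint]
        simp only [ψ, hμ, integral_sq_linear_stdGauss]

end Gaussian

section Ising

variable {N : ℕ}

/-- Couplings between pairs of sites. -/
abbrev Couplings (N : ℕ) := Fin N × Fin N → ℝ

/-- The Boltzmann weight with couplings `J` and site-dependent external field `x`. -/
def boltzmann (J : Couplings N) (x : Fin N → ℝ) (σ : Cfg N) : ℝ :=
  Real.exp (∑ p, J p * (spin (σ p.1) * spin (σ p.2)) + ∑ j, x j * spin (σ j))

/-- The Gibbs average of `f`. -/
def avg (J : Couplings N) (x : Fin N → ℝ) (f : Cfg N → ℝ) : ℝ :=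
  (∑ σ, f σ * boltzmann J x σ) / ∑ σ, boltzmann J x σ

/-- The linear function `∑ u_j σ_j`. -/
def lin (u : Fin N → ℝ) (σ : Cfg N) : ℝ := ∑ j, u j * spin (σ j)

/-- The covariance of `σ_i` and `f` under the Gibbs measure. -/
def cov (J : Couplings N) (x : Fin N → ℝ) (i : Fin N) (f : Cfg N → ℝ) : ℝ :=
  avg J x (fun σ => spin (σ i) * f σ) - avg J x (fun σ => spin (σ i)) * avg J x f

/-- Switch off all couplings involving the site `i`. -/
def cut (i : Fin N) (J : Couplings N) : Couplings N :=
  fun p => if p.1 = i ∨ p.2 = i then 0 else J p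

/-- The field exerted by the site `i` on the other sites. -/
def row (i : Fin N) (J : Couplings N) (j : Fin N) : ℝ := J (i, j) + J (j, i)

lemma abs_spin (b : Bool) : |spin b| = 1 := by cases b <;> simp [spin]

lemma boltzmann_pos (J : Couplings N) (x : Fin N → ℝ) (σ : Cfg N) : 0 < boltzmann J x σ :=
  Real.exp_pos _

lemma sum_boltzmann_pos (J : Couplings N) (x : Fin N → ℝ) : 0 < ∑ σ, boltzmann J x σ :=
  Finset.sum_pos (fun σ _ => boltzmann_pos J x σ) Finset.univ_nonempty

lemma abs_avg_le {J : Couplings N} {x : Fin N → ℝ} {f : Cfg N → ℝ} {B : ℝ}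
    (hf : ∀ σ, |f σ| ≤ B) : |avg J x f| ≤ B := by
  rw [avg, abs_div, abs_of_pos (sum_boltzmann_pos J x), div_le_iff₀ (sum_boltzmann_pos J x),
    Finset.mul_sum]
  refine (Finset.abs_sum_le_sum_abs _ _).trans (Finset.sum_le_sum fun σ _ => ?_)
  rw [abs_mul, abs_of_pos (boltzmann_pos J x σ)]
  exact mul_le_mul_of_nonneg_right (hf σ) (boltzmann_pos J x σ).le

lemma abs_lin_le (u : Fin N → ℝ) (σ : Cfg N) : |lin u σ| ≤ ∑ j, |u j| := by
  refine (Finset.abs_sum_le_sum_abs _ _).trans (Finset.sum_le_sum fun j _ => ?_)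
  rw [abs_mul, abs_spin, mul_one]

lemma abs_cov_le {J : Couplings N} {x : Fin N → ℝ} {i : Fin N} {f : Cfg N → ℝ} {B : ℝ}
    (hf : ∀ σ, |f σ| ≤ B) : |cov J x i f| ≤ 2 * B := by
  have h1 : |avg J x (fun σ => spin (σ i) * f σ)| ≤ B :=
    abs_avg_le fun σ => by rw [abs_mul, abs_spin, one_mul]; exact hf σ
  have h2 : |avg J x (fun σ => spin (σ i))| ≤ 1 := abs_avg_le fun σ => (abs_spin _).le
  have h3 : |avg J x f| ≤ B := abs_avg_le hf
  have h4 : |avg J x (fun σ => spin (σ i)) * avg J x f| ≤ 1 * B := by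
    rw [abs_mul]
    exact mul_le_mul h2 h3 (abs_nonneg _) zero_le_one
  rw [cov]
  exact (abs_sub _ _).trans (by linarith)

lemma continuous_avg {X : Type*} [TopologicalSpace X] {J : X → Couplings N}
    {x : X → Fin N → ℝ} (hJ : Continuous J) (hx : Continuous x) (f : Cfg N → ℝ) :
    Continuous fun q => avg (J q) (x q) f := by
  have hb : ∀ σ, Continuous fun q => boltzmann (J q) (x q) σ := by
    intro σ
    unfold boltzmann
    fun_prop
  unfold avg
  exact (continuous_finsetSum _ fun σ _ => continuous_const.mul (hb σ)).div
    (continuous_finsetSum _ fun σ _ => hb σ) fun q => (sum_boltzmann_pos _ _).ne'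

lemma continuous_cov {X : Type*} [TopologicalSpace X] {J : X → Couplings N}
    {x : X → Fin N → ℝ} (hJ : Continuous J) (hx : Continuous x) (i : Fin N) (f : Cfg N → ℝ) :
    Continuous fun q => cov (J q) (x q) i f := by
  unfold cov
  exact (continuous_avg hJ hx _).sub ((continuous_avg hJ hx _).mul (continuous_avg hJ hx _))

lemma avg_sum_mul {κ : Type*} (s : Finset κ) (J : Couplings N) (x : Fin N → ℝ) (a : κ → ℝ)
    (f : κ → Cfg N → ℝ) :
    avg J x (fun σ => ∑ k ∈ s, a k * f k σ) = ∑ k ∈ s, a k * avg J x (f k) := by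
  simp only [avg, Finset.sum_mul, mul_div_assoc', ← Finset.sum_div]
  rw [Finset.sum_comm]
  simp only [Finset.mul_sum, mul_assoc]

lemma cov_sum_mul {κ : Type*} (s : Finset κ) (J : Couplings N) (x : Fin N → ℝ) (i : Fin N)
    (a : κ → ℝ) (f : κ → Cfg N → ℝ) :
    cov J x i (fun σ => ∑ k ∈ s, a k * f k σ) = ∑ k ∈ s, a k * cov J x i (f k) := by
  have h : (fun σ => spin (σ i) * ∑ k ∈ s, a k * f k σ) =
      fun σ => ∑ k ∈ s, a k * (spin (σ i) * f k σ) := by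
    ext σ
    rw [Finset.mul_sum]
    exact Finset.sum_congr rfl fun k _ => by ring
  simp only [cov]
  rw [h, avg_sum_mul, avg_sum_mul, Finset.mul_sum, ← Finset.sum_sub_distrib]
  exact Finset.sum_congr rfl fun k _ => by ring

lemma cov_lin (J : Couplings N) (x : Fin N → ℝ) (i : Fin N) (u : Fin N → ℝ) :
    cov J x i (lin u) = ∑ j, u j * cov J x i (fun σ => spin (σ j)) :=
  cov_sum_mul _ _ _ _ _ _

/-- The derivative of a Gibbs average along a curve of external fields. -/
lemma hasDerivAt_avg (J : Couplings N) (f : Cfg N → ℝ) {x : ℝ → Fin N → ℝ} {x' : Fin N → ℝ}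
    {t : ℝ} (hx : ∀ j, HasDerivAt (fun s => x s j) (x' j) t) :
    HasDerivAt (fun s => avg J (x s) f) (∑ j, cov J (x t) j f * x' j) t := by
  have hw : ∀ σ, HasDerivAt (fun s => boltzmann J (x s) σ)
      (boltzmann J (x t) σ * lin x' σ) t := by
    intro σ
    refine HasDerivAt.exp (HasDerivAt.const_add _ ?_)
    exact HasDerivAt.fun_sum fun j _ => (hx j).mul_const _
  have hZ := (sum_boltzmann_pos J (x t)).ne'
  have hd := (HasDerivAt.fun_sum (u := Finset.univ) fun σ _ => (hw σ).const_mul (f σ)).fun_div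
    (HasDerivAt.fun_sum (u := Finset.univ) fun σ _ => hw σ) hZ
  convert! hd using 1
  have h1 : ∑ j, cov J (x t) j f * x' j =
      avg J (x t) (fun σ => f σ * lin x' σ) - avg J (x t) f * avg J (x t) (lin x') := by
    have e1 : avg J (x t) (lin x') = ∑ j, x' j * avg J (x t) (fun σ => spin (σ j)) :=
      avg_sum_mul _ _ _ _ _
    have e2 : (fun σ => f σ * lin x' σ) = fun σ => ∑ j, x' j * (spin (σ j) * f σ) := by
      ext σ
      rw [lin, Finset.mul_sum]
      exact Finset.sum_congr rfl fun k _ => by ring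
    rw [e1, e2, avg_sum_mul, Finset.mul_sum, ← Finset.sum_sub_distrib]
    refine Finset.sum_congr rfl fun j _ => ?_
    rw [cov]
    ring
  rw [h1]
  simp only [avg]
  have e4 : ∀ σ, boltzmann J (x t) σ * lin x' σ = lin x' σ * boltzmann J (x t) σ :=
    fun σ => by ring
  simp only [e4]
  field_simp

lemma sum_coupling_eq (i : Fin N) {J : Couplings N} (hJ : J (i, i) = 0) (σ : Cfg N) :
    ∑ p, J p * (spin (σ p.1) * spin (σ p.2)) =
      ∑ p, cut i J p * (spin (σ p.1) * spin (σ p.2)) +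
        spin (σ i) * ∑ j, row i J j * spin (σ j) := by
  have h : ∀ p : Fin N × Fin N, J p * (spin (σ p.1) * spin (σ p.2)) =
      cut i J p * (spin (σ p.1) * spin (σ p.2)) +
        ((if p.1 = i then J (i, p.2) * (spin (σ i) * spin (σ p.2)) else 0) +
          if p.2 = i then J (p.1, i) * (spin (σ p.1) * spin (σ i)) else 0) := by
    rintro ⟨j, k⟩
    by_cases hj : j = i <;> by_cases hk : k = i <;> simp [cut, hj, hk, hJ]
  rw [Finset.sum_congr rfl fun p _ => h p, Finset.sum_add_distrib, Finset.sum_add_distrib]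
  congr 1
  rw [Fintype.sum_prod_type, Fintype.sum_prod_type, Finset.mul_sum]
  rw [Finset.sum_comm]
  simp only [Finset.sum_ite_eq', Finset.mem_univ, if_true]
  rw [← Finset.sum_add_distrib]
  refine Finset.sum_congr rfl fun j _ => ?_
  rw [row]
  ring

/-- Conditionally on `σ_i`, the site `i` acts on the rest of the system as an external field. -/
lemma boltzmann_eq_cut (i : Fin N) {J : Couplings N} (hJ : J (i, i) = 0) (x : Fin N → ℝ)
    (σ : Cfg N) :
    boltzmann J x σ = boltzmann (cut i J) (x + spin (σ i) • row i J) σ := by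
  rw [boltzmann, boltzmann, sum_coupling_eq i hJ]
  congr 1
  simp only [Pi.add_apply, Pi.smul_apply, smul_eq_mul, add_mul, Finset.sum_add_distrib,
    Finset.mul_sum, mul_assoc]
  ring

/-- Reverse the spin at the site `i`. -/
def flipAt (i : Fin N) (σ : Cfg N) : Cfg N := Function.update σ i (!σ i)

lemma flipAt_involutive (i : Fin N) : Function.Involutive (flipAt i) := by
  intro σ
  simp [flipAt]

lemma spin_not (b : Bool) : spin (!b) = -spin b := by cases b <;> simp [spin]

lemma boltzmann_cut_flipAt (i : Fin N) (J : Couplings N) (x : Fin N → ℝ) (σ : Cfg N) :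
    boltzmann (cut i J) x (flipAt i σ) =
      Real.exp (-2 * x i * spin (σ i)) * boltzmann (cut i J) x σ := by
  rw [boltzmann, boltzmann, ← Real.exp_add]
  congr 1
  have h1 : ∀ p : Fin N × Fin N,
      cut i J p * (spin (flipAt i σ p.1) * spin (flipAt i σ p.2)) =
        cut i J p * (spin (σ p.1) * spin (σ p.2)) := by
    rintro ⟨j, k⟩
    by_cases hj : j = i <;> by_cases hk : k = i <;> simp [cut, flipAt, hj, hk]
  have h2 : ∀ j, x j * spin (flipAt i σ j) =
      x j * spin (σ j) + if j = i then -2 * x i * spin (σ i) else 0 := by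
    intro j
    by_cases hj : j = i
    · subst hj
      simp [flipAt, spin_not]
      ring
    · simp [flipAt, hj]
  simp only [h1, h2, Finset.sum_add_distrib, Finset.sum_ite_eq', Finset.mem_univ, if_true]
  ring

lemma sum_eq_sum_restrict (i : Fin N) (J : Couplings N) (x : Fin N → ℝ) {f : Cfg N → ℝ}
    (hf : ∀ σ, f (flipAt i σ) = f σ) (s : Bool) :
    ∑ σ, f σ * boltzmann (cut i J) x σ =
      (1 + Real.exp (-2 * x i * spin s)) *
        ∑ σ, if σ i = s then f σ * boltzmann (cut i J) x σ else 0 := by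
  have h1 : ∑ σ, f σ * boltzmann (cut i J) x σ =
      (∑ σ, if σ i = s then f σ * boltzmann (cut i J) x σ else 0) +
        ∑ σ, if flipAt i σ i = s then f σ * boltzmann (cut i J) x σ else 0 := by
    rw [← Finset.sum_add_distrib]
    refine Finset.sum_congr rfl fun σ _ => ?_
    cases hσ : σ i <;> cases s <;> simp [flipAt, hσ]
  rw [h1, ← Equiv.sum_comp ((flipAt_involutive i).toPerm)
    (fun σ => if flipAt i σ i = s then f σ * boltzmann (cut i J) x σ else 0)]
  rw [add_mul, one_mul, Finset.mul_sum]
  congr 1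
  refine Finset.sum_congr rfl fun σ _ => ?_
  rw [Function.Involutive.coe_toPerm, flipAt_involutive i σ, hf, boltzmann_cut_flipAt]
  split_ifs with h
  · rw [h]; ring
  · simp

/-- The constrained sum over configurations with `σ_i = s`. -/
lemma sum_restrict_eq (i : Fin N) {J : Couplings N} (hJ : J (i, i) = 0) (x : Fin N → ℝ)
    (u : Fin N → ℝ) (s : Bool) :
    (∑ σ, if σ i = s then lin u σ * boltzmann J x σ else 0) =
      (∑ σ, if σ i = s then boltzmann J x σ else 0) *
        (u i * spin s +
          avg (cut i J) (x + spin s • row i J) (lin (Function.update u i 0))) := by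
  set y := x + spin s • row i J with hy
  set u₀ := Function.update u i 0 with hu₀
  have hw : ∀ σ : Cfg N, σ i = s → boltzmann J x σ = boltzmann (cut i J) y σ := by
    intro σ hσ
    rw [boltzmann_eq_cut i hJ, hσ]
  have hlin : ∀ σ : Cfg N, lin u σ = u i * spin (σ i) + lin u₀ σ := by
    intro σ
    have : ∀ j, u j * spin (σ j) =
        (if j = i then u i * spin (σ i) else 0) + u₀ j * spin (σ j) := by
      intro j
      by_cases hj : j = i
      · subst hj; simp [u₀]
      · simp [u₀, hj]
    rw [lin, lin, Finset.sum_congr rfl fun j _ => this j, Finset.sum_add_distrib]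
    simp
  have hlin₀ : ∀ σ, lin u₀ (flipAt i σ) = lin u₀ σ := by
    intro σ
    refine Finset.sum_congr rfl fun j _ => ?_
    by_cases hj : j = i
    · subst hj; simp [u₀]
    · simp [flipAt, hj]
  have h1 := sum_eq_sum_restrict i J y hlin₀ s
  have h2 := sum_eq_sum_restrict i J y (f := fun _ => 1) (fun _ => rfl) s
  simp only [one_mul] at h2
  have hZ := sum_boltzmann_pos (cut i J) y
  have hA : avg (cut i J) y (lin u₀) * (∑ σ, if σ i = s then boltzmann (cut i J) y σ else 0) =
      ∑ σ, if σ i = s then lin u₀ σ * boltzmann (cut i J) y σ else 0 := by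
    have hE : (1 + Real.exp (-2 * y i * spin s)) ≠ 0 := by positivity
    rw [avg, div_mul_eq_mul_div, div_eq_iff hZ.ne', h1, h2]
    ring
  have e1 : (∑ σ, if σ i = s then boltzmann J x σ else 0) =
      ∑ σ, if σ i = s then boltzmann (cut i J) y σ else 0 :=
    Finset.sum_congr rfl fun σ _ => by split_ifs with h <;> simp [hw σ, h]
  rw [e1, mul_add, mul_comm _ (avg _ _ _), hA, mul_comm _ (u i * spin s), Finset.mul_sum,
    ← Finset.sum_add_distrib]
  refine Finset.sum_congr rfl fun σ _ => ?_
  split_ifs with h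
  · rw [hw σ h, hlin, h]; ring
  · simp

/-- The cavity formula bounding a covariance by a discrete derivative in the system where the
site `i` has been decoupled. -/
lemma cov_sq_le (i : Fin N) {J : Couplings N} (hJ : J (i, i) = 0) (x : Fin N → ℝ)
    (u : Fin N → ℝ) :
    cov J x i (lin u) ^ 2 ≤ 2 * u i ^ 2 + 1 / 2 *
      (avg (cut i J) (x + row i J) (lin (Function.update u i 0)) -
        avg (cut i J) (x - row i J) (lin (Function.update u i 0))) ^ 2 := by
  have hT := sum_restrict_eq i hJ x u true
  have hF := sum_restrict_eq i hJ x u false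
  set zT := ∑ σ, if σ i = true then boltzmann J x σ else 0 with hzT
  set zF := ∑ σ, if σ i = false then boltzmann J x σ else 0 with hzF
  have sT : spin true = 1 := by simp [spin]
  have sF : spin false = -1 := by simp [spin]
  rw [sT, one_smul, mul_one] at hT
  rw [sF, neg_one_smul, ← sub_eq_add_neg, mul_neg_one] at hF
  set a := avg (cut i J) (x + row i J) (lin (Function.update u i 0))
  set b := avg (cut i J) (x - row i J) (lin (Function.update u i 0))
  have hZ : ∑ σ, boltzmann J x σ = zT + zF := by
    rw [hzT, hzF, ← Finset.sum_add_distrib]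
    exact Finset.sum_congr rfl fun σ _ => by cases σ i <;> simp
  have hsplit : ∀ f : Cfg N → ℝ, ∑ σ, spin (σ i) * f σ =
      (∑ σ, if σ i = true then f σ else 0) - ∑ σ, if σ i = false then f σ else 0 := by
    intro f
    rw [← Finset.sum_sub_distrib]
    exact Finset.sum_congr rfl fun σ _ => by cases σ i <;> simp [spin]
  have hsum : ∀ f : Cfg N → ℝ, ∑ σ, f σ =
      (∑ σ, if σ i = true then f σ else 0) + ∑ σ, if σ i = false then f σ else 0 := by
    intro f
    rw [← Finset.sum_add_distrib]
    exact Finset.sum_congr rfl fun σ _ => by cases σ i <;> simp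
  have zTn : 0 ≤ zT := Finset.sum_nonneg fun σ _ => by
    split_ifs <;> simp [(boltzmann_pos J x σ).le]
  have zFn : 0 ≤ zF := Finset.sum_nonneg fun σ _ => by
    split_ifs <;> simp [(boltzmann_pos J x σ).le]
  have hpos : 0 < zT + zF := hZ ▸ sum_boltzmann_pos J x
  have hcov : cov J x i (lin u) = 2 * (zT * zF / (zT + zF) ^ 2) * (2 * u i + (a - b)) := by
    simp only [cov, avg, mul_assoc]
    rw [hsplit, hsplit, hsum (fun σ => lin u σ * boltzmann J x σ), hT, hF, hZ, ← hzT, ← hzF]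
    field_simp
    ring
  have hq : zT * zF / (zT + zF) ^ 2 ≤ 1 / 4 := by
    rw [div_le_iff₀ (by positivity)]
    nlinarith [sq_nonneg (zT - zF)]
  have hq0 : 0 ≤ zT * zF / (zT + zF) ^ 2 := by positivity
  rw [hcov, mul_pow]
  have hq2 : (2 * (zT * zF / (zT + zF) ^ 2)) ^ 2 ≤ 1 / 4 := by nlinarith
  calc _ ≤ 1 / 4 * (2 * u i + (a - b)) ^ 2 :=
        mul_le_mul_of_nonneg_right hq2 (sq_nonneg _)
    _ ≤ _ := by nlinarith [sq_nonneg (2 * u i - (a - b))]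

end Ising

section Disorder

variable {N : ℕ}

/-- Coupling strengths without self-interaction, of variance at most `v` for each pair of sites. -/
def IsStrength (v : ℝ) (c : Couplings N) : Prop :=
  (∀ i, c (i, i) = 0) ∧ ∀ i j, c (i, j) ^ 2 + c (j, i) ^ 2 ≤ v

/-- `E |C u|²` for the covariance matrix `C` with coupling strengths `c` and field `x`. -/
def covNormSq (c : Couplings N) (x u : Fin N → ℝ) : ℝ :=
  ∫ g, ∑ j, cov (c * g) x j (lin u) ^ 2 ∂stdGauss (Fin N × Fin N)

lemma IsStrength.cut {v : ℝ} {c : Couplings N} (hc : IsStrength v c) (i : Fin N) :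
    IsStrength v (cut i c) := by
  refine ⟨fun j => ?_, fun j k => ?_⟩
  · simp only [_root_.cut]
    split_ifs
    · rfl
    · exact hc.1 j
  · simp only [_root_.cut]
    have h := hc.2 j k
    have h0 : 0 ≤ v := le_trans (by positivity) h
    by_cases hj : j = i <;> by_cases hk : k = i <;> simp [hj, hk, h0, h]

lemma cut_mul (i : Fin N) (c g : Couplings N) : cut i (c * g) = cut i c * g := by
  ext p
  simp only [cut, Pi.mul_apply]
  split_ifs <;> simp

lemma sq_cov_lin_le (J : Couplings N) (x u : Fin N → ℝ) (i : Fin N) :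
    cov J x i (lin u) ^ 2 ≤ (2 * ∑ j, |u j|) ^ 2 :=
  sq_le_sq' (abs_le.mp (abs_cov_le (abs_lin_le u))).1 (abs_le.mp (abs_cov_le (abs_lin_le u))).2

lemma integrable_of_continuous_of_abs_le {Ω : Type*} [TopologicalSpace Ω] [MeasurableSpace Ω]
    [OpensMeasurableSpace Ω] {μ : Measure Ω} [IsFiniteMeasure μ] {f : Ω → ℝ}
    (hf : Continuous f) {B : ℝ} (hB : ∀ ω, |f ω| ≤ B) : Integrable f μ :=
  Integrable.of_bound hf.measurable.aestronglyMeasurable B (Filter.Eventually.of_forall hB)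

/-- The averaged effect of the site `i` on the rest of the system, for frozen other couplings. -/
lemma integral_sq_avg_row_le {v : ℝ} {c : Couplings N} (hc : IsStrength v c) (i : Fin N)
    (J : Couplings N) (x u : Fin N → ℝ) :
    ∫ b, (avg J (x + row i (c * b)) (lin u) - avg J (x - row i (c * b)) (lin u)) ^ 2
        ∂stdGauss (Fin N × Fin N) ≤
      Real.pi ^ 2 * (v * ∫ b, ∑ j, cov J (x + row i (c * b)) j (lin u) ^ 2
        ∂stdGauss (Fin N × Fin N)) := by
  let a : Couplings N → Fin N → ℝ := fun b => x + row i (c * b)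
  let d : Couplings N → Fin N → ℝ := fun b j => cov J (a b) j (lin u)
  let D : Couplings N → Couplings N := fun b p =>
    (if p.1 = i then c (i, p.2) * d b p.2 else 0) + if p.2 = i then c (p.1, i) * d b p.1 else 0
  have ha : Continuous a := by
    refine continuous_pi fun j => ?_
    simp only [a, row, Pi.add_apply, Pi.mul_apply]
    fun_prop
  have hd : ∀ j, Continuous fun b => d b j := fun j => continuous_cov continuous_const ha _ _
  have hD : Continuous D := by
    refine continuous_pi fun p => ?_
    simp only [D]
    refine Continuous.add ?_ ?_
    · split_ifs
      · exact continuous_const.mul (hd _)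
      · exact continuous_const
    · split_ifs
      · exact continuous_const.mul (hd _)
      · exact continuous_const
  have hlin : ∀ b y : Couplings N, ∑ p, D b p * y p = ∑ j, d b j * row i (c * y) j := by
    intro b y
    have : ∀ p : Fin N × Fin N, D b p * y p =
        (if p.1 = i then c (i, p.2) * d b p.2 * y (i, p.2) else 0) +
          if p.2 = i then c (p.1, i) * d b p.1 * y (p.1, i) else 0 := by
      rintro ⟨j, k⟩
      by_cases hj : j = i <;> by_cases hk : k = i <;> simp [D, hj, hk]
      ring
    rw [Finset.sum_congr rfl fun p _ => this p, Finset.sum_add_distrib, Fintype.sum_prod_type,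
      Fintype.sum_prod_type, Finset.sum_comm]
    simp only [Finset.sum_ite_eq', Finset.mem_univ, if_true]
    rw [← Finset.sum_add_distrib]
    refine Finset.sum_congr rfl fun j _ => ?_
    simp only [row, Pi.mul_apply]
    ring
  have hsq : ∀ b, ∑ p, D b p ^ 2 ≤ v * ∑ j, d b j ^ 2 := by
    intro b
    have : ∀ p : Fin N × Fin N, D b p ^ 2 =
        (if p.1 = i then c (i, p.2) ^ 2 * d b p.2 ^ 2 else 0) +
          if p.2 = i then c (p.1, i) ^ 2 * d b p.1 ^ 2 else 0 := by
      rintro ⟨j, k⟩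
      by_cases hj : j = i <;> by_cases hk : k = i <;> simp [D, hj, hk, hc.1 i, mul_pow]
    rw [Finset.sum_congr rfl fun p _ => this p, Finset.sum_add_distrib, Fintype.sum_prod_type,
      Fintype.sum_prod_type, Finset.sum_comm]
    simp only [Finset.sum_ite_eq', Finset.mem_univ, if_true]
    rw [← Finset.sum_add_distrib, Finset.mul_sum]
    refine Finset.sum_le_sum fun j _ => ?_
    rw [← add_mul]
    exact mul_le_mul_of_nonneg_right (hc.2 i j) (sq_nonneg _)
  have hdB : ∀ b j, |d b j| ≤ 2 * ∑ k, |u k| := fun b j => abs_cov_le (abs_lin_le u)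
  have hS : 0 ≤ ∑ k, |u k| := Finset.sum_nonneg fun k _ => abs_nonneg _
  have hcB : ∀ p, |c p| ≤ ∑ q, |c q| := fun p =>
    Finset.single_le_sum (f := fun q => |c q|) (fun q _ => abs_nonneg _) (Finset.mem_univ p)
  have hDB : ∀ b p, |D b p| ≤ (∑ k, |u k|) + 4 * ((∑ q, |c q|) * ∑ k, |u k|) := by
    intro b p
    have hterm : ∀ q j, |c q * d b j| ≤ (∑ q, |c q|) * (2 * ∑ k, |u k|) := by
      intro q j
      rw [abs_mul]
      exact mul_le_mul (hcB q) (hdB b j) (abs_nonneg _) (Finset.sum_nonneg fun q _ => abs_nonneg _)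
    have h0 : 0 ≤ (∑ q, |c q|) * (2 * ∑ k, |u k|) := (abs_nonneg _).trans (hterm p i)
    have h1 : |if p.1 = i then c (i, p.2) * d b p.2 else 0| ≤
        (∑ q, |c q|) * (2 * ∑ k, |u k|) := by
      split_ifs
      · exact hterm _ _
      · simpa using h0
    have h2 : |if p.2 = i then c (p.1, i) * d b p.1 else 0| ≤
        (∑ q, |c q|) * (2 * ∑ k, |u k|) := by
      split_ifs
      · exact hterm _ _
      · simpa using h0
    refine (abs_add_le _ _).trans ?_
    linarith
  have hneg : ∀ b, a (-b) = x - row i (c * b) := by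
    intro b
    ext j
    simp only [a, row, Pi.add_apply, Pi.sub_apply, Pi.mul_apply, Pi.neg_apply]
    ring
  have hmain := integral_sq_sub_neg_le (F := fun b => avg J (a b) (lin u)) (D := D)
    (B := (∑ k, |u k|) + 4 * ((∑ q, |c q|) * ∑ k, |u k|)) ?_
    (continuous_avg continuous_const ha _) ?_ hD hDB
  · simp only [hneg] at hmain
    refine hmain.trans (mul_le_mul_of_nonneg_left ?_ (sq_nonneg _))
    rw [← integral_const_mul]
    have hdc : Continuous fun b => v * ∑ j, d b j ^ 2 :=
      continuous_const.mul (continuous_finsetSum _ fun j _ => (hd j).pow 2)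
    have hint : Integrable (fun b => v * ∑ j, d b j ^ 2) (stdGauss (Fin N × Fin N)) := by
      refine (integrable_finsetSum _ fun j _ => ?_).const_mul v
      refine integrable_of_continuous_of_abs_le ((hd j).pow 2)
        (B := (2 * ∑ k, |u k|) ^ 2) fun b => ?_
      rw [abs_of_nonneg (sq_nonneg _)]
      exact sq_cov_lin_le _ _ _ _
    exact integral_mono_of_nonneg
      (Filter.Eventually.of_forall fun b => Finset.sum_nonneg fun p _ => sq_nonneg _) hint
      (Filter.Eventually.of_forall hsq)
  · intro γ γ' t hγ
    rw [hlin]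
    refine hasDerivAt_avg J (lin u) fun j => ?_
    simp only [a, row, Pi.add_apply, Pi.mul_apply]
    exact (((hγ (i, j)).const_mul _).add ((hγ (j, i)).const_mul _)).const_add _
  · intro b
    refine (abs_avg_le (abs_lin_le u)).trans ?_
    have : 0 ≤ (∑ q, |c q|) * ∑ k, |u k| :=
      mul_nonneg (Finset.sum_nonneg fun q _ => abs_nonneg _) hS
    linarith

/-- The cavity step: a bound on `E |C u|²` for all systems controls a single entry of `C u`. -/
lemma integral_sq_cov_le {v K : ℝ} (hv : 0 ≤ v)
    (hK : ∀ c : Couplings N, IsStrength v c → ∀ x u, covNormSq c x u ≤ K * ∑ j, u j ^ 2)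
    (hK0 : 0 ≤ K) {c : Couplings N} (hc : IsStrength v c) (x u : Fin N → ℝ) (i : Fin N) :
    ∫ g, cov (c * g) x i (lin u) ^ 2 ∂stdGauss (Fin N × Fin N) ≤
      2 * u i ^ 2 + Real.pi ^ 2 / 2 * v * K * ∑ j, u j ^ 2 := by
  set μ := stdGauss (Fin N × Fin N) with hμ
  set u₀ := Function.update u i 0 with hu₀
  let H : Couplings N × Couplings N → ℝ := fun q =>
    (avg (cut i c * q.1) (x + row i (c * q.2)) (lin u₀) -
      avg (cut i c * q.1) (x - row i (c * q.2)) (lin u₀)) ^ 2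
  have hrow : Continuous fun b : Couplings N => row i (c * b) := by
    refine continuous_pi fun j => ?_
    simp only [row, Pi.mul_apply]
    fun_prop
  have hJ : Continuous fun q : Couplings N × Couplings N => cut i c * q.1 :=
    continuous_const.mul continuous_fst
  have hp : Continuous fun q : Couplings N × Couplings N => x + row i (c * q.2) :=
    continuous_const.add (hrow.comp continuous_snd)
  have hm : Continuous fun q : Couplings N × Couplings N => x - row i (c * q.2) :=
    continuous_const.sub (hrow.comp continuous_snd)
  have hH : Continuous H :=
    ((continuous_avg hJ hp (lin u₀)).sub (continuous_avg hJ hm (lin u₀))).pow 2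
  have hHB : ∀ q, |H q| ≤ (2 * ∑ j, |u₀ j|) ^ 2 := by
    intro q
    simp only [H]
    rw [abs_of_nonneg (sq_nonneg _)]
    have h1 := abs_le.mp (abs_avg_le (J := cut i c * q.1) (x := x + row i (c * q.2))
      (abs_lin_le u₀))
    have h2 := abs_le.mp (abs_avg_le (J := cut i c * q.1) (x := x - row i (c * q.2))
      (abs_lin_le u₀))
    exact sq_le_sq' (by linarith) (by linarith)
  have hHint : Integrable H (μ.prod μ) := integrable_of_continuous_of_abs_le hH hHB
  have hdiag : Continuous fun g : Couplings N => (g, g) := by fun_prop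
  have hHd : Integrable (fun g => H (g, g)) μ :=
    integrable_of_continuous_of_abs_le (hH.comp hdiag) fun g => hHB (g, g)
  have hcovint : Integrable (fun q : Couplings N × Couplings N =>
      ∑ j, cov (cut i c * q.1) (x + row i (c * q.2)) j (lin u₀) ^ 2) (μ.prod μ) := by
    refine integrable_finsetSum _ fun j _ => ?_
    refine integrable_of_continuous_of_abs_le ((continuous_cov hJ hp j (lin u₀)).pow 2)
      (B := (2 * ∑ k, |u₀ k|) ^ 2) fun b => ?_
    rw [abs_of_nonneg (sq_nonneg _)]
    exact sq_cov_lin_le _ _ _ _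
  have hdecouple : ∫ g, H (g, g) ∂μ = ∫ q, H q ∂(μ.prod μ) := by
    have hmp := measurePreserving_mix (fun p : Fin N × Fin N => p.1 = i ∨ p.2 = i)
    have h := integral_map (μ := μ.prod μ) hmp.measurable.aemeasurable
      (f := fun g => H (g, g)) (hH.comp hdiag).measurable.aestronglyMeasurable
    rw [hmp.map_eq] at h
    rw [hμ, h]
    refine integral_congr_ae (Filter.Eventually.of_forall fun q => ?_)
    have e1 : (cut i c * fun p => if p.1 = i ∨ p.2 = i then q.2 p else q.1 p) =
        cut i c * q.1 := by
      ext p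
      simp only [cut, Pi.mul_apply]
      split_ifs <;> simp
    have e2 : row i (c * fun p => if p.1 = i ∨ p.2 = i then q.2 p else q.1 p) =
        row i (c * q.2) := by
      ext j
      simp [row]
    simp only [H, e1, e2]
  have hu₀le : ∑ j, u₀ j ^ 2 ≤ ∑ j, u j ^ 2 := by
    refine Finset.sum_le_sum fun j _ => ?_
    by_cases hj : j = i
    · subst hj; simp [u₀, sq_nonneg]
    · simp [u₀, hj]
  have hprod : ∫ q, H q ∂(μ.prod μ) ≤ Real.pi ^ 2 * (v * (K * ∑ j, u j ^ 2)) := by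
    calc ∫ q, H q ∂(μ.prod μ) = ∫ g, ∫ b, H (g, b) ∂μ ∂μ := integral_prod _ hHint
      _ ≤ ∫ g, Real.pi ^ 2 * (v * ∫ b,
            ∑ j, cov (cut i c * g) (x + row i (c * b)) j (lin u₀) ^ 2 ∂μ) ∂μ :=
          integral_mono hHint.integral_prod_left
            ((hcovint.integral_prod_left.const_mul v).const_mul _)
            fun g => integral_sq_avg_row_le hc i (cut i c * g) x u₀
      _ = Real.pi ^ 2 * (v * ∫ b, covNormSq (cut i c) (x + row i (c * b)) u₀ ∂μ) := by
          rw [integral_const_mul, integral_const_mul, integral_integral_swap hcovint]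
          rfl
      _ ≤ Real.pi ^ 2 * (v * (K * ∑ j, u j ^ 2)) := by
          gcongr
          calc ∫ b, covNormSq (cut i c) (x + row i (c * b)) u₀ ∂μ
              ≤ ∫ _b, K * ∑ j, u j ^ 2 ∂μ :=
                integral_mono hcovint.integral_prod_right (integrable_const _) fun b =>
                  (hK _ (hc.cut i) _ _).trans (mul_le_mul_of_nonneg_left hu₀le hK0)
            _ = K * ∑ j, u j ^ 2 := by simp
  have hii : ∀ g : Couplings N, (c * g) (i, i) = 0 := fun g => by simp [hc.1 i]
  calc ∫ g, cov (c * g) x i (lin u) ^ 2 ∂μ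
      ≤ ∫ g, (2 * u i ^ 2 + 1 / 2 * H (g, g)) ∂μ := by
        refine integral_mono_of_nonneg (Filter.Eventually.of_forall fun g => sq_nonneg _)
          ((integrable_const _).add (hHd.const_mul _))
          (Filter.Eventually.of_forall fun g => ?_)
        have := cov_sq_le i (hii g) x u
        rwa [cut_mul] at this
    _ = 2 * u i ^ 2 + 1 / 2 * ∫ q, H q ∂(μ.prod μ) := by
        rw [integral_add (integrable_const _) (hHd.const_mul _),
          integral_const_mul (1 / 2 : ℝ) fun g => H (g, g), hdecouple]
        simp
    _ ≤ _ := by linarith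

lemma integrable_sq_cov (c : Couplings N) (x u : Fin N → ℝ) (i : Fin N) :
    Integrable (fun g => cov (c * g) x i (lin u) ^ 2) (stdGauss (Fin N × Fin N)) := by
  refine integrable_of_continuous_of_abs_le
    ((continuous_cov (continuous_const.mul continuous_id) continuous_const i (lin u)).pow 2)
    (B := (2 * ∑ k, |u k|) ^ 2) fun b => ?_
  rw [abs_of_nonneg (sq_nonneg _)]
  exact sq_cov_lin_le _ _ _ _

/-- At high temperature, `E |C u|² ≤ 4 |u|²` uniformly in the external field. -/
lemma covNormSq_le {v : ℝ} (hv : 0 ≤ v) (hvN : Real.pi ^ 2 * v * N ≤ 1)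
    {c : Couplings N} (hc : IsStrength v c) (x u : Fin N → ℝ) :
    covNormSq c x u ≤ 4 * ∑ j, u j ^ 2 := by
  have hiter : ∀ m : ℕ, ∀ c : Couplings N, IsStrength v c → ∀ x u,
      covNormSq c x u ≤ (4 + 4 * (N : ℝ) ^ 2 * (1 / 2) ^ m) * ∑ j, u j ^ 2 := by
    intro m
    induction m with
    | zero =>
      intro c _ x u
      have hcs : (∑ j, |u j|) ^ 2 ≤ N * ∑ j, u j ^ 2 := by
        have := sq_sum_le_card_mul_sum_sq (s := Finset.univ) (f := fun j => |u j|)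
        simpa using this
      have h0 : 0 ≤ ∑ j, u j ^ 2 := Finset.sum_nonneg fun j _ => sq_nonneg _
      have hle : covNormSq c x u ≤ N * (2 * ∑ j, |u j|) ^ 2 := by
        calc covNormSq c x u
            ≤ ∫ _g, (N : ℝ) * (2 * ∑ j, |u j|) ^ 2 ∂stdGauss (Fin N × Fin N) := by
              refine integral_mono (integrable_finsetSum _ fun j _ => integrable_sq_cov c x u j)
                (integrable_const _) fun g => ?_
              refine (Finset.sum_le_sum fun j _ => sq_cov_lin_le _ _ _ _).trans ?_
              simp
          _ = N * (2 * ∑ j, |u j|) ^ 2 := by simp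
      have hN : (0 : ℝ) ≤ N := N.cast_nonneg
      have := mul_le_mul_of_nonneg_left hcs hN
      simp only [pow_zero, mul_one]
      nlinarith
    | succ m ih =>
      intro c hc x u
      set K : ℝ := 4 + 4 * (N : ℝ) ^ 2 * (1 / 2) ^ m with hKdef
      have hK0 : 0 ≤ K := by positivity
      have h0 : 0 ≤ ∑ j, u j ^ 2 := Finset.sum_nonneg fun j _ => sq_nonneg _
      have hsum : covNormSq c x u ≤
          ∑ i, (2 * u i ^ 2 + Real.pi ^ 2 / 2 * v * K * ∑ j, u j ^ 2) := by
        rw [covNormSq, integral_finsetSum _ fun j _ => integrable_sq_cov c x u j]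
        exact Finset.sum_le_sum fun i _ => integral_sq_cov_le hv ih hK0 hc x u i
      rw [Finset.sum_add_distrib, ← Finset.mul_sum] at hsum
      simp only [Finset.sum_const, Finset.card_univ, Fintype.card_fin, nsmul_eq_mul] at hsum
      have h1 : (N : ℝ) * (Real.pi ^ 2 / 2 * v * K * ∑ j, u j ^ 2) ≤
          1 / 2 * (K * ∑ j, u j ^ 2) := by
        have := mul_le_mul_of_nonneg_right hvN (mul_nonneg hK0 h0)
        linarith
      calc covNormSq c x u ≤ 2 * ∑ j, u j ^ 2 + 1 / 2 * (K * ∑ j, u j ^ 2) := by linarith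
        _ = _ := by rw [hKdef, pow_succ]; ring
  have hlim : Filter.Tendsto
      (fun m : ℕ => (4 + 4 * (N : ℝ) ^ 2 * (1 / 2) ^ m) * ∑ j, u j ^ 2) Filter.atTop
      (nhds ((4 + 4 * (N : ℝ) ^ 2 * 0) * ∑ j, u j ^ 2)) :=
    (((tendsto_pow_atTop_nhds_zero_of_lt_one (by norm_num) (by norm_num)).const_mul _).const_add
      _).mul_const _
  have := ge_of_tendsto' hlim fun m => hiter m c hc x u
  simpa using this

/-- At high temperature, the averaged row sums of the covariance matrix are bounded. -/
lemma abs_integral_sum_cov_le {v : ℝ} (hv : 0 ≤ v) (hvN : Real.pi ^ 2 * v * N ≤ 1)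
    {c : Couplings N} (hc : IsStrength v c) (x : Fin N → ℝ) (i : Fin N) :
    |∫ g, cov (c * g) x i (lin fun _ => 1) ∂stdGauss (Fin N × Fin N)| ≤ 2 := by
  have h := integral_sq_cov_le hv (fun c hc x u => covNormSq_le hv hvN hc x u) (by norm_num) hc x
    (fun _ => 1) i
  have hint : Integrable (fun g => cov (c * g) x i (lin fun _ => 1))
      (stdGauss (Fin N × Fin N)) :=
    integrable_of_continuous_of_abs_le
      (continuous_cov (continuous_const.mul continuous_id) continuous_const i _)
      fun g => abs_cov_le (abs_lin_le _)
  have hvar : (∫ g, cov (c * g) x i (lin fun _ => 1) ∂stdGauss (Fin N × Fin N)) ^ 2 ≤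
      ∫ g, cov (c * g) x i (lin fun _ => 1) ^ 2 ∂stdGauss (Fin N × Fin N) := by
    set m := ∫ g, cov (c * g) x i (lin fun _ => 1) ∂stdGauss (Fin N × Fin N) with hm
    have h0 : 0 ≤ ∫ g, (cov (c * g) x i (lin fun _ => 1) - m) ^ 2 ∂stdGauss (Fin N × Fin N) :=
      integral_nonneg fun g => sq_nonneg _
    have e : ∀ g, (cov (c * g) x i (lin fun _ => 1) - m) ^ 2 =
        cov (c * g) x i (lin fun _ => 1) ^ 2 - 2 * m * cov (c * g) x i (lin fun _ => 1) +
          m ^ 2 := fun g => by ring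
    simp only [e] at h0
    have hsub : Integrable (fun g => cov (c * g) x i (lin fun _ => 1) ^ 2 -
        2 * m * cov (c * g) x i (lin fun _ => 1)) (stdGauss (Fin N × Fin N)) :=
      (integrable_sq_cov c x _ i).sub (hint.const_mul _)
    rw [integral_add hsub (integrable_const _),
      integral_sub (integrable_sq_cov c x _ i) (hint.const_mul _), integral_const_mul, ← hm] at h0
    simp at h0
    nlinarith
  simp only [one_pow, Finset.sum_const, Finset.card_univ, Fintype.card_fin, nsmul_eq_mul,
    mul_one] at h
  refine abs_le_of_sq_le_sq (hvar.trans ?_) (by norm_num)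
  nlinarith

end Disorder

section Exchangeability

variable {N : ℕ}

lemma map_curry_stdGauss (N : ℕ) :
    (stdGauss (Fin N × Fin N)).map (MeasurableEquiv.curry (Fin N) (Fin N) ℝ) = gaussN N := by
  have h := Measure.infinitePi_map_curry (X := ℝ)
    (fun (_ : Fin N) (_ : Fin N) => (gaussianReal 0 1 : Measure ℝ))
  simp only [Measure.infinitePi_eq_pi] at h
  exact h

lemma integral_gaussN (Φ : (Fin N → Fin N → ℝ) → ℝ) :
    ∫ G, Φ G ∂gaussN N = ∫ g, Φ (fun i j => g (i, j)) ∂stdGauss (Fin N × Fin N) := by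
  rw [← map_curry_stdGauss, integral_map_equiv]
  rfl

/-- The coupling strengths of the SK model. -/
def skStrength (N : ℕ) (β : ℝ) : Couplings N :=
  fun p => if p.1 < p.2 then β / Real.sqrt N else 0

lemma exp_negH (β h : ℝ) (g : Couplings N) (σ : Cfg N) :
    Real.exp (negH N β h (fun i j => g (i, j)) σ) =
      boltzmann (skStrength N β * g) (fun _ => h) σ := by
  rw [boltzmann, negH, Fintype.sum_prod_type, Finset.mul_sum, Finset.mul_sum]
  congr 2
  refine Finset.sum_congr rfl fun i _ => ?_
  rw [Finset.mul_sum]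
  refine Finset.sum_congr rfl fun j _ => ?_
  simp only [skStrength, Pi.mul_apply]
  split_ifs <;> ring

lemma isStrength_skStrength (N : ℕ) (β : ℝ) : IsStrength (β ^ 2 / N) (skStrength N β) := by
  have hsq : (β / Real.sqrt N) ^ 2 = β ^ 2 / N := by
    rw [div_pow, Real.sq_sqrt N.cast_nonneg]
  refine ⟨fun i => by simp [skStrength], fun i j => ?_⟩
  have h0 : 0 ≤ β ^ 2 / N := by positivity
  rcases lt_trichotomy i j with h | h | h
  · simp [skStrength, h, h.not_gt, hsq]
  · simp [skStrength, h, h0]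
  · simp [skStrength, h, h.not_gt, hsq]

/-- Gibbs averages over two replicas of products of differences are covariances. -/
lemma gibbs_eq_cov (β h : ℝ) (g : Couplings N) (i j : Fin N) :
    gibbs N β h (fun i j => g (i, j)) (fun σs : Fin 2 → Cfg N =>
        (spin (σs 0 i) - spin (σs 1 i)) * (spin (σs 0 j) - spin (σs 1 j))) =
      2 * cov (skStrength N β * g) (fun _ => h) i (fun σ => spin (σ j)) := by
  simp only [gibbs, exp_negH, Fin.prod_univ_two, Fintype.card_fin]
  set w := boltzmann (skStrength N β * g) fun _ => h with hw
  have hZ : ∑ σ, w σ ≠ 0 := (sum_boltzmann_pos _ _).ne'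
  have hsum : ∑ σs : Fin 2 → Cfg N, (spin (σs 0 i) - spin (σs 1 i)) *
      (spin (σs 0 j) - spin (σs 1 j)) * (w (σs 0) * w (σs 1)) =
      ∑ σ, ∑ τ, (spin (σ i) - spin (τ i)) * (spin (σ j) - spin (τ j)) * (w σ * w τ) := by
    rw [← Fintype.sum_prod_type', ← (finTwoArrowEquiv (Cfg N)).sum_comp]
    rfl
  have hexp : ∑ σ, ∑ τ, (spin (σ i) - spin (τ i)) * (spin (σ j) - spin (τ j)) * (w σ * w τ) =
      2 * ((∑ σ, spin (σ i) * spin (σ j) * w σ) * (∑ σ, w σ) -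
        (∑ σ, spin (σ i) * w σ) * ∑ σ, spin (σ j) * w σ) := by
    have e1 := Finset.sum_mul_sum univ univ (fun σ => spin (σ i) * spin (σ j) * w σ) w
    have e2 := Finset.sum_mul_sum univ univ w (fun σ => spin (σ i) * spin (σ j) * w σ)
    have e3 := Finset.sum_mul_sum univ univ (fun σ => spin (σ i) * w σ) fun σ => spin (σ j) * w σ
    have e4 := Finset.sum_mul_sum univ univ (fun σ => spin (σ j) * w σ) fun σ => spin (σ i) * w σ
    have e : ∑ σ, ∑ τ, (spin (σ i) - spin (τ i)) * (spin (σ j) - spin (τ j)) * (w σ * w τ) =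
        (∑ σ, spin (σ i) * spin (σ j) * w σ) * (∑ σ, w σ) +
          (∑ σ, w σ) * (∑ σ, spin (σ i) * spin (σ j) * w σ) -
          (∑ σ, spin (σ i) * w σ) * (∑ σ, spin (σ j) * w σ) -
          (∑ σ, spin (σ j) * w σ) * ∑ σ, spin (σ i) * w σ := by
      rw [e1, e2, e3, e4]
      simp only [← Finset.sum_add_distrib, ← Finset.sum_sub_distrib]
      exact Finset.sum_congr rfl fun σ _ => Finset.sum_congr rfl fun τ _ => by ring
    rw [e]
    ring
  rw [hsum, hexp]
  simp only [cov, avg, ← hw]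
  field_simp

/-- The action of a permutation of the sites on pairs of sites, preserving their orientation. -/
def orient (π : Equiv.Perm (Fin N)) (p : Fin N × Fin N) : Fin N × Fin N :=
  if p.1 < p.2 ↔ π p.1 < π p.2 then (π p.1, π p.2) else (π p.2, π p.1)

lemma orient_involutive {π : Equiv.Perm (Fin N)} (hπ : Function.Involutive π) :
    Function.Involutive (orient π) := by
  rintro ⟨i, j⟩
  have hne : i ≠ j → π i ≠ π j := fun h => π.injective.ne h
  by_cases h : i < j ↔ π i < π j
  · have h' : π i < π j ↔ i < j := h.symm
    simp [orient, h', hπ i, hπ j]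
  · rcases lt_trichotomy i j with h1 | h1 | h1
    · have h2 : π j < π i := by have := hne h1.ne; grind
      simp [orient, h1, h2, h1.not_gt, h2.not_gt, hπ i, hπ j]
    · simp [h1] at h
    · have h2 : π i < π j := by have := hne h1.ne'; grind
      simp [orient, h1, h2, h1.not_gt, h2.not_gt, hπ i, hπ j]

lemma skStrength_orient (β : ℝ) (π : Equiv.Perm (Fin N)) (p : Fin N × Fin N) :
    skStrength N β (orient π p) = skStrength N β p := by
  rcases p with ⟨i, j⟩
  have hne : i ≠ j → π i ≠ π j := fun h => π.injective.ne h
  unfold skStrength orient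
  grind

lemma boltzmann_orient (β h : ℝ) {π : Equiv.Perm (Fin N)} (hπ : Function.Involutive π)
    (g : Couplings N) (σ : Cfg N) :
    boltzmann (skStrength N β * fun p => g (orient π p)) (fun _ => h) σ =
      boltzmann (skStrength N β * g) (fun _ => h) (fun j => σ (π j)) := by
  rw [boltzmann, boltzmann, ← Equiv.sum_comp (orient_involutive hπ).toPerm,
    ← Equiv.sum_comp π fun j => h * spin (σ j)]
  congr 2
  refine Finset.sum_congr rfl fun p _ => ?_
  simp only [Function.Involutive.coe_toPerm, Pi.mul_apply, skStrength_orient,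
    orient_involutive hπ p]
  congr 1
  unfold orient
  split_ifs
  · rfl
  · exact mul_comm _ _

lemma avg_orient (β h : ℝ) {π : Equiv.Perm (Fin N)} (hπ : Function.Involutive π)
    (g : Couplings N) (f : Cfg N → ℝ) :
    avg (skStrength N β * fun p => g (orient π p)) (fun _ => h) f =
      avg (skStrength N β * g) (fun _ => h) fun σ => f fun j => σ (π j) := by
  have hcomp : Function.Involutive fun (σ : Cfg N) j => σ (π j) := fun σ => by
    ext j
    simp [hπ j]
  simp only [avg, boltzmann_orient β h hπ]
  rw [← Equiv.sum_comp hcomp.toPerm fun σ => boltzmann (skStrength N β * g) (fun _ => h) σ,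
    ← Equiv.sum_comp hcomp.toPerm fun σ =>
      (f fun j => σ (π j)) * boltzmann (skStrength N β * g) (fun _ => h) σ]
  simp [hπ _]

/-- Exchangeability of the sites other than `i`. -/
lemma integral_cov_eq (β h : ℝ) {i j k : Fin N} (hj : i ≠ j) (hk : i ≠ k) :
    ∫ g, cov (skStrength N β * g) (fun _ => h) i (fun σ => spin (σ j))
        ∂stdGauss (Fin N × Fin N) =
      ∫ g, cov (skStrength N β * g) (fun _ => h) i (fun σ => spin (σ k))
        ∂stdGauss (Fin N × Fin N) := by
  set π := Equiv.swap j k with hπdef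
  have hπ : Function.Involutive π := fun l => Equiv.swap_apply_self j k l
  have hi : π i = i := Equiv.swap_apply_of_ne_of_ne hj hk
  have hmp : MeasurePreserving (fun (g : Couplings N) p => g (orient π p))
      (stdGauss (Fin N × Fin N)) (stdGauss (Fin N × Fin N)) :=
    (measurePreserving_piCongrLeft (fun _ => (gaussianReal 0 1 : Measure ℝ))
      (orient_involutive hπ).toPerm).symm
  have hc : Continuous fun g : Couplings N =>
      cov (skStrength N β * g) (fun _ => h) i (fun σ => spin (σ j)) :=
    continuous_cov (continuous_const.mul continuous_id) continuous_const _ _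
  have hint := integral_map (μ := stdGauss (Fin N × Fin N)) hmp.measurable.aemeasurable
    hc.measurable.aestronglyMeasurable
  rw [hmp.map_eq] at hint
  rw [hint]
  refine integral_congr_ae (Filter.Eventually.of_forall fun g => ?_)
  simp only [cov, avg_orient β h hπ, hi]
  simp [hπdef]

end Exchangeability

/-- at high temperature, `|ν(σ̄₁ σ̄_N)| ≤ L/N` (with `N = M+1`;
`σ̄_i = σ_i¹ − σ_i²` for two independent replicas). -/
theorem stmt11 :
    ∃ β₀ L : ℝ, 0 < β₀ ∧ 0 < L ∧
      ∀ β : ℝ, 0 < β → β < β₀ → ∀ h : ℝ, 0 ≤ h → ∀ M : ℕ,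
        |nu (M + 1) β h
            (fun σs : Fin 2 → Cfg (M + 1) =>
              (spin (σs 0 0) - spin (σs 1 0)) *
                (spin (σs 0 (Fin.last M)) - spin (σs 1 (Fin.last M))))| ≤
          L / (M + 1) := by
  refine ⟨1 / 4, 16, by norm_num, by norm_num, fun β hβ hβ₀ h _ M => ?_⟩
  have hM : (0 : ℝ) < M + 1 := by positivity
  let C : Fin (M + 1) → ℝ := fun j =>
    ∫ g, cov (skStrength (M + 1) β * g) (fun _ => h) 0 (fun σ => spin (σ j))
      ∂stdGauss (Fin (M + 1) × Fin (M + 1))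
  have hcovB : ∀ j (g : Couplings (M + 1)),
      |cov (skStrength (M + 1) β * g) (fun _ => h) 0 (fun σ => spin (σ j))| ≤ 2 := fun j g =>
    (abs_cov_le fun σ => (abs_spin _).le).trans (by norm_num)
  have hint : ∀ j, Integrable (fun g : Couplings (M + 1) =>
      cov (skStrength (M + 1) β * g) (fun _ => h) 0 (fun σ => spin (σ j)))
      (stdGauss (Fin (M + 1) × Fin (M + 1))) := fun j =>
    integrable_of_continuous_of_abs_le
      (continuous_cov (continuous_const.mul continuous_id) continuous_const _ _) (hcovB j)
  have hCB : ∀ j, |C j| ≤ 2 := fun j => by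
    have := norm_integral_le_of_norm_le_const (μ := stdGauss (Fin (M + 1) × Fin (M + 1)))
      (C := 2) (Filter.Eventually.of_forall fun g => (Real.norm_eq_abs _).trans_le (hcovB j g))
    simpa using this
  have hnu : nu (M + 1) β h (fun σs : Fin 2 → Cfg (M + 1) =>
      (spin (σs 0 0) - spin (σs 1 0)) *
        (spin (σs 0 (Fin.last M)) - spin (σs 1 (Fin.last M)))) = 2 * C (Fin.last M) := by
    rw [nu, integral_gaussN]
    simp only [gibbs_eq_cov]
    rw [integral_const_mul]
  rw [hnu, abs_mul, abs_two]
  have htemp : Real.pi ^ 2 * (β ^ 2 / (M + 1 : ℕ)) * (M + 1 : ℕ) ≤ 1 := by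
    have hN : ((M + 1 : ℕ) : ℝ) ≠ 0 := by positivity
    rw [mul_assoc, div_mul_cancel₀ _ hN, ← mul_pow]
    have hle : Real.pi * β ≤ 4 * (1 / 4) :=
      mul_le_mul Real.pi_le_four hβ₀.le hβ.le (by norm_num)
    exact pow_le_one₀ (by positivity) (by linarith)
  have hrow := abs_integral_sum_cov_le (by positivity) htemp (isStrength_skStrength (M + 1) β)
    (fun _ => h) 0
  simp only [cov_lin, one_mul] at hrow
  rw [integral_finsetSum _ fun j _ => hint j] at hrow
  change |∑ j, C j| ≤ 2 at hrow
  have hsum : ∑ j, C j = C 0 + M * C (Fin.last M) := by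
    rcases M.eq_zero_or_pos with rfl | hpos
    · simp
    · rw [Fin.sum_univ_succ]
      have hlast : (0 : Fin (M + 1)) ≠ Fin.last M := by
        simp [Fin.ext_iff]
        omega
      rw [Finset.sum_congr rfl fun j _ =>
        integral_cov_eq β h (Fin.succ_ne_zero j).symm hlast]
      simp [C]
  rw [hsum] at hrow
  have h0 := abs_le.mp (hCB 0)
  have hl := abs_le.mp (hCB (Fin.last M))
  have hr := abs_le.mp hrow
  rw [le_div_iff₀ hM]
  have hkey : |C (Fin.last M) * (M + 1)| ≤ 6 := abs_le.mpr ⟨by linarith, by linarith⟩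
  rw [abs_mul, abs_of_pos hM] at hkey
  linarith

end
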